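/- Let N_M, N_l, N_F be positive integers and set N = N_F(N_M−1)+1. For every tensor Y ∈ ℂ^{N_M×N_l×N_F}, the atomic norm of Y equals the optimal value of the semidefinite program: ‖Y‖_A = sup { Re⟨Q, Y⟩ : Q ∈ ℂ^{N_M×N_l×N_F}, and there exists a Hermitian matrix P₀ ∈ ℂ^{N×N} such that the block matrix [[P₀, Q̃],[Q̃^H, I_{N_l N_F}]] is positive semidefinite and ∑_{i=1}^{N−k} P₀(i, i+k) = δ_{k,0} for all k = 0, 1, …, N−1 }, where Q̃ = [R_1(Q_1) … R_{N_F}(Q_{N_F})] ∈ ℂ^{N×N_l N_F} is the lifted version of Q and Q_1,…,Q_{N_F} are the frequency slices of Q. -/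

import Mathlib

open Matrix BigOperators
open scoped ComplexOrder

noncomputable section

/-- Array manifold vector `a(f,w) ∈ ℂ^{N_M}`, with `a(f,w)_m = exp(-2πi·w·f·(m-1))`
(0-indexed: entry `m` is `exp(-2πi·w·f·m)`). -/
def aVec (N_M : ℕ) (f : ℕ) (w : ℝ) : Fin N_M → ℂ :=
  fun m => Complex.exp ((-(2 * Real.pi * w * f * (m : ℕ)) : ℝ) * Complex.I)

/-- Frobenius norm of a complex matrix. -/
def frobNorm {m n : Type*} [Fintype m] [Fintype n] (X : Matrix m n ℂ) : ℝ :=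
  Real.sqrt (∑ i, ∑ j, Complex.normSq (X i j))

/-- The atom `A(w) * Xᵀ ∈ ℂ^{N_M × N_l × N_F}`: its `f`-th frequency slice is the
rank-one matrix `a(f,w) · (row f of X)` (frequency index `f : Fin N_F` encodes frequency `f+1`). -/
def atomTensor (N_M N_l N_F : ℕ) (w : ℝ) (X : Matrix (Fin N_F) (Fin N_l) ℂ) :
    Fin N_M → Fin N_l → Fin N_F → ℂ :=
  fun m l f => aVec N_M ((f : ℕ) + 1) w m * X f l

/-- The atomic norm `‖Y‖_A` of a tensor `Y ∈ ℂ^{N_M × N_l × N_F}`. -/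
def atomicNorm (N_M N_l N_F : ℕ) (Y : Fin N_M → Fin N_l → Fin N_F → ℂ) : ℝ :=
  sInf { r : ℝ | ∃ (K : ℕ) (c : Fin K → ℝ) (w : Fin K → ℝ)
    (X : Fin K → Matrix (Fin N_F) (Fin N_l) ℂ),
    (∀ k, 0 ≤ c k) ∧ (∀ k, w k ∈ Set.Icc (-(1:ℝ)/2) (1/2)) ∧
    (∀ k, frobNorm (X k) = 1) ∧
    (∀ m l f, Y m l f = ∑ k, (c k : ℂ) * atomTensor N_M N_l N_F (w k) (X k) m l f) ∧
    r = ∑ k, c k }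

/-- The lifting map `R_f : ℂ^{N_M×N_l} → ℂ^{N×N_l}`: row `m` of `Q` is placed in row
`f·(m-1)+1` (0-indexed: row `f·m`) of the output, all other rows are zero. -/
def Rlift (N_M N_l N : ℕ) (f : ℕ) (Q : Matrix (Fin N_M) (Fin N_l) ℂ) :
    Matrix (Fin N) (Fin N_l) ℂ :=
  fun i l => ∑ m : Fin N_M, if (i : ℕ) = f * (m : ℕ) then Q m l else 0

/-- The lifted matrix `Q̃ = [R_1(Q_1) … R_{N_F}(Q_{N_F})] ∈ ℂ^{N × N_l N_F}`, with (frequency, snapshot)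
pairs indexing the columns. -/
def Qtilde (N_M N_l N_F N : ℕ) (Q : Fin N_M → Fin N_l → Fin N_F → ℂ) :
    Matrix (Fin N) (Fin N_F × Fin N_l) ℂ :=
  fun i q => Rlift N_M N_l N ((q.1 : ℕ) + 1) (fun m l => Q m l q.1) i q.2

/-- Real inner product of tensors, `⟨Q,Y⟩_ℝ = Re ∑ conj(Q)·Y`. -/
def reInner {α β γ : Type*} [Fintype α] [Fintype β] [Fintype γ]
    (Q Y : α → β → γ → ℂ) : ℝ :=
  (∑ m, ∑ l, ∑ f, (starRingEnd ℂ) (Q m l f) * Y m l f).re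

open Polynomial in
theorem eq_of_eval_eq_on_circle {P R : ℂ[X]}
    (h : ∀ z : ℂ, ‖z‖ = 1 → P.eval z = R.eval z) : P = R := by
  refine Polynomial.eq_of_infinite_eval_eq P R (Set.Infinite.mono (s := Metric.sphere 0 1) ?_ ?_)
  · intro z hz
    exact h z (by simpa using hz)
  · refine IsPreconnected.infinite_of_nontrivial
      (isPreconnected_sphere (by simp [Complex.rank_real_complex]) 0 1) ?_
    exact ⟨1, by simp, -1, by simp, by norm_num⟩

theorem conj_eq_inv_of_norm_eq_one {z : ℂ} (hz : ‖z‖ = 1) :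
    (starRingEnd ℂ) z = z⁻¹ := by
  rw [Complex.inv_def, Complex.normSq_eq_norm_sq, hz]; simp

open Polynomial in
theorem eval_inv_reflect_mul_pow {x : ℂ} (hx : x ≠ 0) {N : ℕ} {f : ℂ[X]} (hf : f.natDegree ≤ N) :
    (reflect N f).eval x⁻¹ * x ^ N = f.eval x := by
  let := invertibleOfNonzero hx
  have h := eval₂_reflect_mul_pow (RingHom.id ℂ) x N f hf
  rwa [invOf_eq_inv] at h

open Polynomial in
theorem eq_reflect_conj_of_real_on_circle {n : ℕ} {P : ℂ[X]} (hdeg : P.natDegree ≤ 2 * n)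
    (hP : ∀ z : ℂ, ‖z‖ = 1 → ∃ r : ℝ, P.eval z = r * z ^ n) :
    P = reflect (2 * n) (P.map (starRingEnd ℂ)) := by
  apply eq_of_eval_eq_on_circle
  intro z hz
  have hz0 : z ≠ 0 := by rintro rfl; simp at hz
  have key := eval_inv_reflect_mul_pow (N := 2 * n) (f := P.map (starRingEnd ℂ))
    (inv_ne_zero hz0) (by simpa using hdeg)
  have hconj : (P.map (starRingEnd ℂ)).eval z⁻¹ = (starRingEnd ℂ) (P.eval z) := by
    rw [← conj_eq_inv_of_norm_eq_one hz, eval_map, eval₂_at_apply]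
  rw [hconj, inv_inv] at key
  obtain ⟨r, hr⟩ := hP z hz
  rw [hr] at key ⊢
  simp only [map_mul, map_pow, Complex.conj_ofReal, conj_eq_inv_of_norm_eq_one hz] at key
  have hzz : z * z⁻¹ = 1 := mul_inv_cancel₀ hz0
  refine mul_right_cancel₀ (pow_ne_zero (2 * n) (inv_ne_zero hz0)) ?_
  rw [key, two_mul, pow_add, mul_assoc, ← mul_assoc (z ^ n), ← mul_pow, hzz, one_pow, one_mul]

open Polynomial in
/-- Fejér–Riesz factorization of a strictly positive trigonometric polynomial `z ^ (-n) * P z`. -/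
theorem exists_fejer_riesz_factor (n : ℕ) (P : ℂ[X]) (hdeg : P.natDegree ≤ 2 * n)
    (hP : ∀ z : ℂ, ‖z‖ = 1 → ∃ r : ℝ, 0 < r ∧ P.eval z = r * z ^ n) :
    ∃ h : ℂ[X], h.natDegree ≤ n ∧ ∀ z : ℂ, ‖z‖ = 1 →
      P.eval z = z ^ n * (h.eval z * (starRingEnd ℂ) (h.eval z)) := by
  induction n generalizing P with
  | zero =>
    obtain ⟨r, hr, h1⟩ := hP 1 (by simp)
    obtain ⟨c, rfl⟩ := natDegree_eq_zero.1 (Nat.le_zero.1 hdeg)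
    refine ⟨C (Real.sqrt r : ℂ), by simp, fun z _ => ?_⟩
    simp only [eval_C, pow_zero, mul_one, one_mul, Complex.conj_ofReal] at h1 ⊢
    rw [h1, ← Complex.ofReal_mul, Real.mul_self_sqrt hr.le]
  | succ n ih =>
    have hrefl := eq_reflect_conj_of_real_on_circle hdeg
      (fun z hz => (hP z hz).imp fun _ h => h.2)
    have hcoeff : P.coeff (2 * (n + 1)) = (starRingEnd ℂ) (P.coeff 0) := by
      conv_lhs => rw [hrefl]
      rw [coeff_reflect, revAt_le le_rfl, coeff_map, Nat.sub_self]
    by_cases h0 : P.coeff 0 = 0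
    · obtain ⟨R, rfl⟩ := X_dvd_iff.2 h0
      have hRdeg : R.natDegree ≤ 2 * n := by
        rcases eq_or_ne R 0 with rfl | hR
        · simp
        rw [natDegree_X_mul hR] at hdeg
        by_contra hlt
        have heq : R.natDegree = 2 * n + 1 := by omega
        rw [h0, map_zero, show 2 * (n + 1) = R.natDegree + 1 by omega, coeff_X_mul] at hcoeff
        exact hR (leadingCoeff_eq_zero.1 hcoeff)
      obtain ⟨h, hh, hev⟩ := ih R hRdeg fun z hz => by
        obtain ⟨r, hr, e⟩ := hP z hz
        have hz0 : z ≠ 0 := by rintro rfl; simp at hz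
        refine ⟨r, hr, mul_left_cancel₀ hz0 ?_⟩
        rw [eval_mul, eval_X] at e
        rw [e]; ring
      refine ⟨h, by omega, fun z hz => ?_⟩
      rw [eval_mul, eval_X, hev z hz]; ring
    · have hne : P.coeff (2 * (n + 1)) ≠ 0 := by rw [hcoeff]; simpa using h0
      have hd : P.natDegree = 2 * (n + 1) := le_antisymm hdeg (le_natDegree_of_ne_zero hne)
      obtain ⟨α, hα⟩ := Complex.exists_root
        (natDegree_pos_iff_degree_pos.1 (by omega : 0 < P.natDegree))
      have hα0 : α ≠ 0 := by
        rintro rfl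
        exact h0 (by rw [coeff_zero_eq_eval_zero]; exact hα)
      have hαn : ‖α‖ ≠ 1 := by
        intro hn
        obtain ⟨r, hr, e⟩ := hP α hn
        rw [hα.eq_zero] at e
        have := mul_ne_zero (Complex.ofReal_ne_zero.2 hr.ne') (pow_ne_zero (n + 1) hα0)
        exact this e.symm
      set a := (starRingEnd ℂ) α with ha
      have ha0 : a ≠ 0 := by simpa [ha] using hα0
      have hβ : P.eval a⁻¹ = 0 := by
        have key := eval_inv_reflect_mul_pow (N := 2 * (n + 1)) (f := P.map (starRingEnd ℂ))
          ha0 (by simpa using hdeg)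
        rw [← hrefl, ha, eval_map, eval₂_at_apply, hα.eq_zero, map_zero] at key
        exact (mul_eq_zero.1 key).resolve_right (pow_ne_zero _ ha0)
      have hne' : a⁻¹ - α ≠ 0 := by
        intro he
        have h1 : α * a = 1 := by rw [← sub_eq_zero.1 he, inv_mul_cancel₀ ha0]
        rw [ha, Complex.mul_conj, Complex.normSq_eq_norm_sq] at h1
        have h2 : ‖α‖ ^ 2 = 1 := by exact_mod_cast h1
        exact hαn (by nlinarith [norm_nonneg α])
      obtain ⟨R₁, hR₁⟩ := dvd_iff_isRoot.2 hα
      have hR₁0 : R₁.IsRoot a⁻¹ := by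
        rw [hR₁, eval_mul] at hβ
        exact (mul_eq_zero.1 hβ).resolve_left (by simpa using hne')
      obtain ⟨R₂, rfl⟩ := dvd_iff_isRoot.2 hR₁0
      have hR₂ : R₂ ≠ 0 := by
        rintro rfl
        exact h0 (by simp [hR₁])
      have hR₂deg : R₂.natDegree = 2 * n := by
        rw [hR₁, natDegree_mul (X_sub_C_ne_zero _) (mul_ne_zero (X_sub_C_ne_zero _) hR₂),
          natDegree_mul (X_sub_C_ne_zero _) hR₂, natDegree_X_sub_C, natDegree_X_sub_C] at hd
        omega
      have hfac : ∀ z : ℂ, ‖z‖ = 1 → P.eval z =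
          z * ((z - α) * (starRingEnd ℂ) (z - α)) * (C (-a⁻¹) * R₂).eval z := by
        intro z hz
        have hz0 : z ≠ 0 := by rintro rfl; simp at hz
        rw [hR₁]
        simp only [eval_mul, eval_sub, eval_X, eval_C, map_sub, conj_eq_inv_of_norm_eq_one hz,
          ← ha]
        field_simp
        ring
      obtain ⟨h, hh, hev⟩ := ih (C (-a⁻¹) * R₂)
        ((natDegree_C_mul_le _ _).trans hR₂deg.le) fun z hz => by
          obtain ⟨r, hr, e⟩ := hP z hz
          have hz0 : z ≠ 0 := by rintro rfl; simp at hz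
          have hzα : z - α ≠ 0 := by
            intro he
            exact hαn (by rw [← sub_eq_zero.1 he, hz])
          have hpos := Complex.normSq_pos.2 hzα
          refine ⟨r / Complex.normSq (z - α), by positivity, ?_⟩
          rw [hfac z hz, Complex.mul_conj] at e
          have hc : (Complex.normSq (z - α) : ℂ) ≠ 0 := Complex.ofReal_ne_zero.2 hpos.ne'
          push_cast
          rw [div_mul_eq_mul_div, eq_div_iff hc]
          refine mul_left_cancel₀ hz0 ?_
          linear_combination e
      refine ⟨(X - C α) * h, ?_, fun z hz => ?_⟩
      · refine natDegree_mul_le.trans ?_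
        rw [natDegree_X_sub_C]; omega
      · rw [hfac z hz, hev z hz]
        simp only [eval_mul, eval_sub, eval_X, eval_C, map_mul]
        ring

/-- The sesquilinear form `∑ i j, z ^ i * M i j * conj (z ^ j)`, that is, `aᴴ M a` for the
vector `a` with entries `conj (z ^ i)`. -/
def circleForm {N : ℕ} (M : Matrix (Fin N) (Fin N) ℂ) (z : ℂ) : ℂ :=
  ∑ i : Fin N, ∑ j : Fin N, z ^ (i : ℕ) * M i j * (starRingEnd ℂ) (z ^ (j : ℕ))

theorem circleForm_add {N : ℕ} (M M' : Matrix (Fin N) (Fin N) ℂ) (z : ℂ) :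
    circleForm (M + M') z = circleForm M z + circleForm M' z := by
  simp only [circleForm, Matrix.add_apply, mul_add, add_mul, Finset.sum_add_distrib]

theorem circleForm_mul_conjTranspose {N : ℕ} {ι : Type*} [Fintype ι]
    (B : Matrix (Fin N) ι ℂ) (z : ℂ) :
    circleForm (B * Bᴴ) z =
      ((∑ c, Complex.normSq (∑ i : Fin N, z ^ (i : ℕ) * B i c) : ℝ) : ℂ) := by
  push_cast
  simp only [circleForm, ← Complex.mul_conj, map_sum, Finset.sum_mul_sum]
  simp only [Matrix.mul_apply, Finset.mul_sum, Finset.sum_mul, Matrix.conjTranspose_apply]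
  rw [Finset.sum_comm (s := (Finset.univ : Finset ι))]
  refine Finset.sum_congr rfl fun i _ => ?_
  rw [Finset.sum_comm]
  refine Finset.sum_congr rfl fun c _ => Finset.sum_congr rfl fun j _ => ?_
  rw [map_mul, starRingEnd_apply (B j c)]
  ring

theorem circleForm_nonneg {N : ℕ} {M : Matrix (Fin N) (Fin N) ℂ} (hM : M.PosSemidef) (z : ℂ) :
    0 ≤ circleForm M z := by
  have h := hM.dotProduct_mulVec_nonneg (fun i => (starRingEnd ℂ) (z ^ (i : ℕ)))
  simpa [dotProduct, mulVec, Finset.mul_sum, circleForm, mul_assoc] using h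

open Polynomial in
/-- The polynomial `z ^ (N - 1) * circleForm M z`. -/
def circlePoly {N : ℕ} (M : Matrix (Fin N) (Fin N) ℂ) : ℂ[X] :=
  ∑ i : Fin N, ∑ j : Fin N, C (M i j) * X ^ (N - 1 + i - j)

theorem circlePoly_natDegree_le {N : ℕ} (M : Matrix (Fin N) (Fin N) ℂ) :
    (circlePoly M).natDegree ≤ 2 * (N - 1) := by
  refine Polynomial.natDegree_sum_le_of_forall_le _ _ fun i _ =>
    Polynomial.natDegree_sum_le_of_forall_le _ _ fun j _ =>
      (Polynomial.natDegree_C_mul_X_pow_le _ _).trans ?_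
  omega

theorem circlePoly_eval {N : ℕ} (M : Matrix (Fin N) (Fin N) ℂ) {z : ℂ} (hz : ‖z‖ = 1) :
    (circlePoly M).eval z = z ^ (N - 1) * circleForm M z := by
  have hz0 : z ≠ 0 := by rintro rfl; simp at hz
  simp only [circlePoly, circleForm, Polynomial.eval_finsetSum, Polynomial.eval_mul,
    Polynomial.eval_C, Polynomial.eval_pow, Polynomial.eval_X, Finset.mul_sum]
  refine Finset.sum_congr rfl fun i _ => Finset.sum_congr rfl fun j _ => ?_
  rw [pow_sub₀ z hz0 (by omega), pow_add, map_pow, conj_eq_inv_of_norm_eq_one hz, inv_pow]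
  ring

theorem circlePoly_coeff {N : ℕ} (M : Matrix (Fin N) (Fin N) ℂ) {k : ℕ} (hk : k < N) :
    (circlePoly M).coeff (N - 1 - k) =
      ∑ i : Fin N, ∑ j : Fin N, if (j : ℕ) = (i : ℕ) + k then M i j else 0 := by
  simp only [circlePoly, Polynomial.finsetSum_coeff, Polynomial.coeff_C_mul,
    Polynomial.coeff_X_pow, mul_ite, mul_one, mul_zero]
  refine Finset.sum_congr rfl fun i _ => Finset.sum_congr rfl fun j _ => ?_
  congr 1
  apply propext
  omega

theorem circlePoly_coeff_reflect {N : ℕ} {M : Matrix (Fin N) (Fin N) ℂ} (hM : M.IsHermitian)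
    {k : ℕ} (hk : k < N) :
    (circlePoly M).coeff (N - 1 + k) = (starRingEnd ℂ) ((circlePoly M).coeff (N - 1 - k)) := by
  simp only [circlePoly, Polynomial.finsetSum_coeff, Polynomial.coeff_C_mul,
    Polynomial.coeff_X_pow, mul_ite, mul_one, mul_zero, map_sum]
  rw [Finset.sum_comm]
  refine Finset.sum_congr rfl fun i _ => Finset.sum_congr rfl fun j _ => ?_
  rw [apply_ite (starRingEnd ℂ), map_zero, starRingEnd_apply, hM.apply]
  congr 1
  apply propext
  omega

theorem circleForm_eq_one_of_diagonal_sums {N : ℕ} (hN : 0 < N) {M : Matrix (Fin N) (Fin N) ℂ}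
    (hM : M.IsHermitian)
    (hsum : ∀ k : ℕ, k < N →
      (∑ i : Fin N, ∑ j : Fin N, if (j : ℕ) = (i : ℕ) + k then M i j else 0)
        = if k = 0 then 1 else 0) {z : ℂ} (hz : ‖z‖ = 1) :
    circleForm M z = 1 := by
  have hpoly : circlePoly M = Polynomial.X ^ (N - 1) := by
    ext d
    rw [Polynomial.coeff_X_pow]
    have hlow : ∀ k < N, (circlePoly M).coeff (N - 1 - k) = if k = 0 then 1 else 0 :=
      fun k hk => (circlePoly_coeff M hk).trans (hsum k hk)
    rcases le_or_gt d (N - 1) with hd | hd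
    · have h := hlow (N - 1 - d) (by omega)
      rw [Nat.sub_sub_self hd] at h
      rw [h]
      congr 1
      apply propext
      omega
    · rw [if_neg hd.ne']
      rcases le_or_gt d (2 * (N - 1)) with hd' | hd'
      · have h := circlePoly_coeff_reflect hM (k := d - (N - 1)) (by omega)
        rw [hlow _ (by omega), if_neg (by omega), map_zero] at h
        rwa [show N - 1 + (d - (N - 1)) = d by omega] at h
      · exact Polynomial.coeff_eq_zero_of_natDegree_lt
          ((circlePoly_natDegree_le M).trans_lt hd')
  have h := circlePoly_eval M hz
  have hz0 : z ≠ 0 := by rintro rfl; simp at hz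
  rw [hpoly, Polynomial.eval_pow, Polynomial.eval_X] at h
  exact mul_left_cancel₀ (pow_ne_zero (N - 1) hz0) (by rw [← h, mul_one])

theorem exists_bounded_real_certificate {N : ℕ} (hN : 0 < N) {ι : Type*} [Fintype ι]
    [DecidableEq ι] (B : Matrix (Fin N) ι ℂ)
    (hB : ∀ z : ℂ, ‖z‖ = 1 → ∑ c, Complex.normSq (∑ i : Fin N, z ^ (i : ℕ) * B i c) < 1) :
    ∃ P₀ : Matrix (Fin N) (Fin N) ℂ, P₀.IsHermitian ∧
      (Matrix.fromBlocks P₀ B Bᴴ (1 : Matrix ι ι ℂ)).PosSemidef ∧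
      ∀ k : ℕ, k < N →
        (∑ i : Fin N, ∑ j : Fin N, if (j : ℕ) = (i : ℕ) + k then P₀ i j else 0)
          = if k = 0 then 1 else 0 := by
  obtain ⟨h, hdeg, hh⟩ := exists_fejer_riesz_factor (N - 1)
    (Polynomial.X ^ (N - 1) - circlePoly (B * Bᴴ))
    ((Polynomial.natDegree_sub_le _ _).trans (max_le (by simp; omega)
      (circlePoly_natDegree_le _)))
    fun z hz => by
      refine ⟨1 - ∑ c, Complex.normSq (∑ i : Fin N, z ^ (i : ℕ) * B i c),
        sub_pos.2 (hB z hz), ?_⟩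
      rw [Polynomial.eval_sub, circlePoly_eval _ hz, circleForm_mul_conjTranspose,
        Polynomial.eval_pow, Polynomial.eval_X]
      push_cast
      ring
  let H : Matrix (Fin N) Unit ℂ := fun i _ => h.coeff i
  have hPoly : circlePoly (B * Bᴴ + H * Hᴴ) = Polynomial.X ^ (N - 1) := by
    refine eq_of_eval_eq_on_circle fun z hz => ?_
    have e := hh z hz
    have hH : ∑ i : Fin N, z ^ (i : ℕ) * H i () = h.eval z := by
      rw [Polynomial.eval_eq_sum_range' (Nat.lt_of_le_pred hN hdeg),
        ← Fin.sum_univ_eq_sum_range (fun i => h.coeff i * z ^ i)]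
      exact Finset.sum_congr rfl fun i _ => mul_comm _ _
    rw [Polynomial.eval_sub, circlePoly_eval _ hz] at e
    rw [circlePoly_eval _ hz, circleForm_add, circleForm_mul_conjTranspose H]
    simp only [Finset.univ_unique, Finset.sum_singleton, PUnit.default_eq_unit, hH]
    rw [← Complex.mul_conj, mul_add, ← e]
    ring
  refine ⟨B * Bᴴ + H * Hᴴ, ?_, ?_, fun k hk => ?_⟩
  · exact (Matrix.isHermitian_mul_conjTranspose_self B).add
      (Matrix.isHermitian_mul_conjTranspose_self H)
  · let := invertibleOne (α := Matrix ι ι ℂ)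
    rw [Matrix.PosDef.fromBlocks₂₂ _ _ Matrix.PosDef.one]
    simpa using Matrix.posSemidef_self_mul_conjTranspose H
  · rw [← circlePoly_coeff _ hk, hPoly, Polynomial.coeff_X_pow]
    congr 1
    apply propext
    omega

theorem sum_normSq_le_one_of_certificate {N : ℕ} (hN : 0 < N) {ι : Type*} [Fintype ι]
    [DecidableEq ι] {B : Matrix (Fin N) ι ℂ} {P₀ : Matrix (Fin N) (Fin N) ℂ}
    (hP₀ : P₀.IsHermitian) (hpsd : (Matrix.fromBlocks P₀ B Bᴴ (1 : Matrix ι ι ℂ)).PosSemidef)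
    (hsum : ∀ k : ℕ, k < N →
      (∑ i : Fin N, ∑ j : Fin N, if (j : ℕ) = (i : ℕ) + k then P₀ i j else 0)
        = if k = 0 then 1 else 0) {z : ℂ} (hz : ‖z‖ = 1) :
    ∑ c, Complex.normSq (∑ i : Fin N, z ^ (i : ℕ) * B i c) ≤ 1 := by
  let := invertibleOne (α := Matrix ι ι ℂ)
  rw [Matrix.PosDef.fromBlocks₂₂ _ _ Matrix.PosDef.one, inv_one, Matrix.mul_one] at hpsd
  have h := circleForm_add (P₀ - B * Bᴴ) (B * Bᴴ) z
  rw [sub_add_cancel, circleForm_eq_one_of_diagonal_sums hN hP₀ hsum hz,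
    circleForm_mul_conjTranspose] at h
  have h0 := circleForm_nonneg hpsd z
  rw [← sub_eq_iff_eq_add.2 h, sub_nonneg] at h0
  exact_mod_cast h0

section AtomicNorm

variable {N_M N_l N_F : ℕ}

/-- The total weights of the finite atomic decompositions of `Y`; `atomicNorm` is its infimum. -/
def atomicCosts (N_M N_l N_F : ℕ) (Y : Fin N_M → Fin N_l → Fin N_F → ℂ) : Set ℝ :=
  { r : ℝ | ∃ (K : ℕ) (c : Fin K → ℝ) (w : Fin K → ℝ)
    (X : Fin K → Matrix (Fin N_F) (Fin N_l) ℂ),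
    (∀ k, 0 ≤ c k) ∧ (∀ k, w k ∈ Set.Icc (-(1:ℝ)/2) (1/2)) ∧
    (∀ k, frobNorm (X k) = 1) ∧
    (∀ m l f, Y m l f = ∑ k, (c k : ℂ) * atomTensor N_M N_l N_F (w k) (X k) m l f) ∧
    r = ∑ k, c k }

theorem atomicNorm_eq_sInf (Y : Fin N_M → Fin N_l → Fin N_F → ℂ) :
    atomicNorm N_M N_l N_F Y = sInf (atomicCosts N_M N_l N_F Y) := rfl

theorem sum_mem_atomicCosts {ι : Type*} [Fintype ι] {Y : Fin N_M → Fin N_l → Fin N_F → ℂ}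
    {c w : ι → ℝ} {X : ι → Matrix (Fin N_F) (Fin N_l) ℂ} (hc : ∀ k, 0 ≤ c k)
    (hw : ∀ k, w k ∈ Set.Icc (-(1:ℝ)/2) (1/2)) (hX : ∀ k, frobNorm (X k) = 1)
    (hY : ∀ m l f, Y m l f = ∑ k, (c k : ℂ) * atomTensor N_M N_l N_F (w k) (X k) m l f) :
    ∑ k, c k ∈ atomicCosts N_M N_l N_F Y := by
  let e := (Fintype.equivFin ι).symm
  refine ⟨Fintype.card ι, c ∘ e, w ∘ e, X ∘ e, fun k => hc _, fun k => hw _, fun k => hX _,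
    fun m l f => ?_, (e.sum_comp c).symm⟩
  rw [hY]
  exact (e.sum_comp fun k => (c k : ℂ) * atomTensor N_M N_l N_F (w k) (X k) m l f).symm

theorem frobNorm_sq {m n : Type*} [Fintype m] [Fintype n] (X : Matrix m n ℂ) :
    frobNorm X ^ 2 = ∑ i, ∑ j, Complex.normSq (X i j) :=
  Real.sq_sqrt (Finset.sum_nonneg fun _ _ => Finset.sum_nonneg fun _ _ => Complex.normSq_nonneg _)

theorem frobNorm_nonneg {m n : Type*} [Fintype m] [Fintype n] (X : Matrix m n ℂ) :
    0 ≤ frobNorm X :=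
  Real.sqrt_nonneg _

theorem frobNorm_smul {m n : Type*} [Fintype m] [Fintype n] (t : ℂ) (X : Matrix m n ℂ) :
    frobNorm (t • X) = ‖t‖ * frobNorm X := by
  rw [← Real.sqrt_sq (norm_nonneg t), frobNorm, frobNorm, ← Real.sqrt_mul (sq_nonneg _),
    ← Complex.normSq_eq_norm_sq]
  simp [Finset.mul_sum]

theorem eq_zero_of_frobNorm_eq_zero {m n : Type*} [Fintype m] [Fintype n] {X : Matrix m n ℂ}
    (h : frobNorm X = 0) : X = 0 := by
  have h2 := frobNorm_sq X
  rw [h, zero_pow two_ne_zero] at h2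
  have h3 := (Finset.sum_eq_zero_iff_of_nonneg fun _ _ =>
    Finset.sum_nonneg fun _ _ => Complex.normSq_nonneg _).1 h2.symm
  ext i j
  exact Complex.normSq_eq_zero.1 ((Finset.sum_eq_zero_iff_of_nonneg fun _ _ =>
    Complex.normSq_nonneg _).1 (h3 i (Finset.mem_univ i)) j (Finset.mem_univ j))

theorem exists_frobNorm_eq_one_smul {m n : Type*} [Fintype m] [Fintype n] [Nonempty m] [Nonempty n]
    (X : Matrix m n ℂ) : ∃ X' : Matrix m n ℂ, frobNorm X' = 1 ∧ X = (frobNorm X : ℂ) • X' := by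
  classical
  rcases eq_or_ne (frobNorm X) 0 with h | h
  · inhabit m
    inhabit n
    refine ⟨Matrix.single default default 1, ?_, ?_⟩
    · rw [frobNorm, Real.sqrt_eq_one, Fintype.sum_eq_single default, Fintype.sum_eq_single default]
      · simp
      · intro j hj; simp [hj.symm]
      · intro i hi; simp [hi.symm]
    · rw [h, eq_zero_of_frobNorm_eq_zero h]; simp
  · refine ⟨((frobNorm X)⁻¹ : ℂ) • X, ?_, ?_⟩
    · rw [frobNorm_smul, norm_inv, Complex.norm_real, Real.norm_of_nonneg (frobNorm_nonneg X),
        inv_mul_cancel₀ h]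
    · rw [smul_smul, mul_inv_cancel₀ (Complex.ofReal_ne_zero.2 h), one_smul]

theorem atomTensor_smul (w : ℝ) (t : ℂ) (X : Matrix (Fin N_F) (Fin N_l) ℂ) :
    atomTensor N_M N_l N_F w (t • X) = t • atomTensor N_M N_l N_F w X := by
  ext m l f
  simp [atomTensor, mul_left_comm]

theorem sum_frobNorm_mem_atomicCosts (hl : 0 < N_l) (hF : 0 < N_F) {ι : Type*} [Fintype ι]
    {Y : Fin N_M → Fin N_l → Fin N_F → ℂ} {w : ι → ℝ} {X : ι → Matrix (Fin N_F) (Fin N_l) ℂ}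
    (hw : ∀ k, w k ∈ Set.Icc (-(1:ℝ)/2) (1/2))
    (hY : ∀ m l f, Y m l f = ∑ k, atomTensor N_M N_l N_F (w k) (X k) m l f) :
    ∑ k, frobNorm (X k) ∈ atomicCosts N_M N_l N_F Y := by
  have := Fin.pos_iff_nonempty.1 hl
  have := Fin.pos_iff_nonempty.1 hF
  choose X' hX' hX using fun k => exists_frobNorm_eq_one_smul (X k)
  refine sum_mem_atomicCosts (fun k => frobNorm_nonneg _) hw hX' fun m l f => ?_
  rw [hY]
  refine Finset.sum_congr rfl fun k _ => ?_
  conv_lhs => rw [hX k, atomTensor_smul]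
  rfl

theorem nonneg_of_mem_atomicCosts {Y : Fin N_M → Fin N_l → Fin N_F → ℂ} {r : ℝ}
    (hr : r ∈ atomicCosts N_M N_l N_F Y) : 0 ≤ r := by
  obtain ⟨K, c, w, X, hc, -, -, -, rfl⟩ := hr
  exact Finset.sum_nonneg fun k _ => hc k

theorem bddBelow_atomicCosts (Y : Fin N_M → Fin N_l → Fin N_F → ℂ) :
    BddBelow (atomicCosts N_M N_l N_F Y) :=
  ⟨0, fun _ => nonneg_of_mem_atomicCosts⟩

theorem add_mem_atomicCosts {Y Z : Fin N_M → Fin N_l → Fin N_F → ℂ} {r s : ℝ}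
    (hr : r ∈ atomicCosts N_M N_l N_F Y) (hs : s ∈ atomicCosts N_M N_l N_F Z) :
    r + s ∈ atomicCosts N_M N_l N_F (Y + Z) := by
  obtain ⟨K, c, w, X, hc, hw, hX, hY, rfl⟩ := hr
  obtain ⟨K', c', w', X', hc', hw', hX', hZ, rfl⟩ := hs
  have h := sum_mem_atomicCosts (Y := Y + Z) (c := Sum.elim c c') (w := Sum.elim w w')
    (X := Sum.elim X X') (by rintro (k | k); exacts [hc k, hc' k])
    (by rintro (k | k); exacts [hw k, hw' k]) (by rintro (k | k); exacts [hX k, hX' k])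
    (fun m l f => by simp [hY, hZ])
  simpa using h

theorem smul_mem_atomicCosts {Y : Fin N_M → Fin N_l → Fin N_F → ℂ} {r t : ℝ} (ht : 0 ≤ t)
    (hr : r ∈ atomicCosts N_M N_l N_F Y) : t * r ∈ atomicCosts N_M N_l N_F (t • Y) := by
  obtain ⟨K, c, w, X, hc, hw, hX, hY, rfl⟩ := hr
  refine ⟨K, fun k => t * c k, w, X, fun k => mul_nonneg ht (hc k), hw, hX, fun m l f => ?_,
    Finset.mul_sum ..⟩
  simp [hY, Finset.mul_sum, mul_assoc]

theorem exists_sum_mul_pow_eq {n : ℕ} {v : Fin n → ℂ} (hv : Function.Injective v)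
    (y : Fin n → ℂ) : ∃ b : Fin n → ℂ, ∀ m : Fin n, y m = ∑ j, v j ^ (m : ℕ) * b j := by
  have hdet : IsUnit (vandermonde v)ᵀ.det := by
    rw [det_transpose, isUnit_iff_ne_zero]
    exact det_vandermonde_ne_zero_iff.2 hv
  refine ⟨(vandermonde v)ᵀ⁻¹ *ᵥ y, fun m => ?_⟩
  have h : (vandermonde v)ᵀ *ᵥ ((vandermonde v)ᵀ⁻¹ *ᵥ y) = y := by
    rw [mulVec_mulVec, mul_nonsing_inv _ hdet, one_mulVec]
  exact (congrFun h m).symm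

theorem exp_neg_pi_mul_div_injective (n : ℕ) : Function.Injective fun j : Fin n =>
    Complex.exp ((-(Real.pi * ((j : ℕ) / n)) : ℝ) * Complex.I) := by
  intro i j hij
  have hn : (0 : ℝ) < n := by exact_mod_cast i.pos
  have hlt : ∀ k : Fin n, ((k : ℕ) : ℝ) / n < 1 := fun k => by
    rw [div_lt_one hn]; exact_mod_cast k.isLt
  have hnn : ∀ k : Fin n, (0 : ℝ) ≤ ((k : ℕ) : ℝ) / n := fun k => by positivity
  have h := Complex.exp_inj_of_neg_pi_lt_of_le_pi
    (by simp only [Complex.im_ofReal_mul, Complex.I_im]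
        nlinarith [hlt i, Real.pi_pos])
    (by simp only [Complex.im_ofReal_mul, Complex.I_im]
        nlinarith [hnn i, Real.pi_pos])
    (by simp only [Complex.im_ofReal_mul, Complex.I_im]
        nlinarith [hlt j, Real.pi_pos])
    (by simp only [Complex.im_ofReal_mul, Complex.I_im]
        nlinarith [hnn j, Real.pi_pos]) hij
  have h2 := Complex.ofReal_injective (mul_right_cancel₀ Complex.I_ne_zero h)
  have h3 := mul_left_cancel₀ Real.pi_ne_zero (neg_injective h2)
  rw [div_left_inj' hn.ne'] at h3
  exact Fin.ext (by exact_mod_cast h3)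

theorem atomicCosts_nonempty (hl : 0 < N_l) (hF : 0 < N_F)
    (Y : Fin N_M → Fin N_l → Fin N_F → ℂ) : (atomicCosts N_M N_l N_F Y).Nonempty := by
  choose b hb using fun (l : Fin N_l) (f : Fin N_F) =>
    exists_sum_mul_pow_eq (exp_neg_pi_mul_div_injective N_M) fun m => Y m l f
  refine ⟨_, sum_frobNorm_mem_atomicCosts hl hF (ι := (Fin N_F × Fin N_l) × Fin N_M)
    (w := fun k => (k.2 : ℕ) / N_M / (2 * ((k.1.1 : ℕ) + 1)))
    (X := fun k => Matrix.single k.1.1 k.1.2 (b k.1.2 k.1.1 k.2)) (fun k => ?_)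
    fun m l f => ?_⟩
  · have hM : (0 : ℝ) < N_M := by exact_mod_cast k.2.pos
    have h1 : ((k.2 : ℕ) : ℝ) / N_M ≤ 1 := by
      rw [div_le_one hM]; exact_mod_cast k.2.isLt.le
    have h2 : (0 : ℝ) ≤ ((k.1.1 : ℕ) : ℝ) := by positivity
    constructor
    · have : 0 ≤ ((k.2 : ℕ) : ℝ) / N_M / (2 * (((k.1.1 : ℕ) : ℝ) + 1)) := by positivity
      linarith
    · rw [div_le_div_iff₀ (by positivity) (by norm_num)]
      nlinarith
  · rw [Fintype.sum_prod_type, Fintype.sum_eq_single (f, l), hb l f m]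
    · refine Finset.sum_congr rfl fun j _ => ?_
      rw [atomTensor, Matrix.single_apply_same, aVec, ← Complex.exp_nat_mul]
      congr 2
      have hf : ((f : ℕ) : ℝ) + 1 ≠ 0 := by positivity
      rw [← mul_assoc, ← Complex.ofReal_natCast, ← Complex.ofReal_mul]
      congr 2
      push_cast
      field_simp
    · rintro ⟨f', l'⟩ hne
      refine Finset.sum_eq_zero fun j _ => ?_
      rw [atomTensor, Matrix.single_apply_of_ne, mul_zero]
      rintro ⟨rfl, rfl⟩
      exact hne rfl

theorem atomicNorm_nonneg (Y : Fin N_M → Fin N_l → Fin N_F → ℂ) :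
    0 ≤ atomicNorm N_M N_l N_F Y :=
  Real.sInf_nonneg fun _ => nonneg_of_mem_atomicCosts

theorem atomicNorm_add_le (hl : 0 < N_l) (hF : 0 < N_F) (Y Z : Fin N_M → Fin N_l → Fin N_F → ℂ) :
    atomicNorm N_M N_l N_F (Y + Z) ≤ atomicNorm N_M N_l N_F Y + atomicNorm N_M N_l N_F Z := by
  simp only [atomicNorm_eq_sInf]
  rw [← csInf_add (atomicCosts_nonempty hl hF Y) (bddBelow_atomicCosts Y)
    (atomicCosts_nonempty hl hF Z) (bddBelow_atomicCosts Z)]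
  refine csInf_le_csInf (bddBelow_atomicCosts _)
    ((atomicCosts_nonempty hl hF Y).add (atomicCosts_nonempty hl hF Z)) ?_
  rintro _ ⟨r, hr, s, hs, rfl⟩
  exact add_mem_atomicCosts hr hs

theorem atomicNorm_smul_le (hl : 0 < N_l) (hF : 0 < N_F) {t : ℝ} (ht : 0 < t)
    (Y : Fin N_M → Fin N_l → Fin N_F → ℂ) :
    atomicNorm N_M N_l N_F (t • Y) ≤ t * atomicNorm N_M N_l N_F Y := by
  rw [mul_comm, ← div_le_iff₀ ht]
  refine le_csInf (atomicCosts_nonempty hl hF Y) fun r hr => ?_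
  rw [div_le_iff₀ ht, mul_comm]
  exact csInf_le (bddBelow_atomicCosts _) (smul_mem_atomicCosts ht.le hr)

theorem atomicNorm_smul (hl : 0 < N_l) (hF : 0 < N_F) {t : ℝ} (ht : 0 < t)
    (Y : Fin N_M → Fin N_l → Fin N_F → ℂ) :
    atomicNorm N_M N_l N_F (t • Y) = t * atomicNorm N_M N_l N_F Y := by
  refine le_antisymm (atomicNorm_smul_le hl hF ht Y) ?_
  have h := atomicNorm_smul_le hl hF (inv_pos.2 ht) (t • Y)
  rwa [smul_smul, inv_mul_cancel₀ ht.ne', one_smul, inv_mul_eq_div, le_div_iff₀ ht, mul_comm] at h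

theorem atomicNorm_atomTensor_le (hl : 0 < N_l) (hF : 0 < N_F) {w : ℝ}
    (hw : w ∈ Set.Icc (-(1:ℝ)/2) (1/2)) (X : Matrix (Fin N_F) (Fin N_l) ℂ) :
    atomicNorm N_M N_l N_F (atomTensor N_M N_l N_F w X) ≤ frobNorm X :=
  csInf_le (bddBelow_atomicCosts _) (by
    have h := sum_frobNorm_mem_atomicCosts (Y := atomTensor N_M N_l N_F w X) hl hF (ι := Unit)
      (w := fun _ => w) (X := fun _ => X) (fun _ => hw) (fun m l f => by simp)
    rwa [Fintype.sum_unique] at h)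

theorem exists_eq_reInner {α β γ : Type*} [Fintype α] [Fintype β] [Fintype γ]
    (g : (α → β → γ → ℂ) →ₗ[ℝ] ℝ) : ∃ Q : α → β → γ → ℂ, ∀ Z, g Z = reInner Q Z := by
  classical
  let e : α → β → γ → ℂ → (α → β → γ → ℂ) := fun m l f x =>
    Pi.single m (Pi.single l (Pi.single f x))
  refine ⟨fun m l f => ⟨g (e m l f 1), g (e m l f Complex.I)⟩, fun Z => ?_⟩
  have hZ : Z = ∑ m, ∑ l, ∑ f, ((Z m l f).re • e m l f 1 + (Z m l f).im • e m l f Complex.I) := by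
    have he : ∀ m l f, (Z m l f).re • e m l f 1 + (Z m l f).im • e m l f Complex.I
        = e m l f (Z m l f) := fun m l f => by
      simp only [e, ← Pi.single_smul, ← Pi.single_add]
      simp
    simp only [he, e]
    ext m l f
    simp [Finset.sum_apply, Pi.single_apply, ite_apply]
  conv_lhs => rw [hZ]
  simp only [map_sum, map_add, map_smul, reInner, Complex.re_sum, Complex.mul_re,
    Complex.conj_re, Complex.conj_im, smul_eq_mul]
  refine Finset.sum_congr rfl fun m _ => Finset.sum_congr rfl fun l _ =>
    Finset.sum_congr rfl fun f _ => ?_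
  ring

theorem exists_reInner_eq_atomicNorm (hl : 0 < N_l) (hF : 0 < N_F)
    (Y : Fin N_M → Fin N_l → Fin N_F → ℂ) :
    ∃ Q : Fin N_M → Fin N_l → Fin N_F → ℂ, atomicNorm N_M N_l N_F Y ≤ reInner Q Y ∧
      ∀ Z, reInner Q Z ≤ atomicNorm N_M N_l N_F Z := by
  have h0 : atomicNorm N_M N_l N_F 0 = 0 := by
    have := atomicNorm_smul hl hF (N_M := N_M) two_pos 0
    rw [smul_zero] at this
    linarith
  rcases eq_or_ne Y 0 with rfl | hY
  · refine ⟨0, ?_, fun Z => ?_⟩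
    · simp [h0, reInner]
    · simpa [reInner] using atomicNorm_nonneg Z
  obtain ⟨g, hg, hle⟩ := exists_extension_of_le_sublinear
    (LinearPMap.mkSpanSingleton (K := ℝ) Y (atomicNorm N_M N_l N_F Y) hY)
    (atomicNorm N_M N_l N_F) (fun c hc Z => atomicNorm_smul hl hF hc Z)
    (atomicNorm_add_le hl hF) (by
      rintro ⟨x, hx⟩
      obtain ⟨t, rfl⟩ := Submodule.mem_span_singleton.1 hx
      rw [LinearPMap.mkSpanSingleton'_apply, smul_eq_mul]
      rcases lt_or_ge 0 t with ht | ht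
      · exact (atomicNorm_smul hl hF ht Y).ge
      · exact (mul_nonpos_of_nonpos_of_nonneg ht (atomicNorm_nonneg Y)).trans
          (atomicNorm_nonneg _))
  obtain ⟨Q, hQ⟩ := exists_eq_reInner g
  refine ⟨Q, ?_, fun Z => hQ Z ▸ hle Z⟩
  have h := hg ⟨Y, Submodule.mem_span_singleton_self Y⟩
  rw [LinearPMap.mkSpanSingleton_apply] at h
  rw [← hQ]
  exact h.ge

theorem sum_pow_mul_Qtilde {N : ℕ} (hN : N = N_F * (N_M - 1) + 1)
    (Q : Fin N_M → Fin N_l → Fin N_F → ℂ) (z : ℂ) (p : Fin N_F × Fin N_l) :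
    ∑ i : Fin N, z ^ (i : ℕ) * Qtilde N_M N_l N_F N Q i p =
      ∑ m : Fin N_M, z ^ (((p.1 : ℕ) + 1) * (m : ℕ)) * Q m p.2 p.1 := by
  simp only [Qtilde, Rlift, Finset.mul_sum]
  rw [Finset.sum_comm]
  refine Finset.sum_congr rfl fun m _ => ?_
  have hlt : ((p.1 : ℕ) + 1) * (m : ℕ) < N := by
    rw [hN]
    exact Nat.lt_succ_of_le (Nat.mul_le_mul p.1.isLt (Nat.le_sub_one_of_lt m.isLt))
  rw [Fintype.sum_eq_single ⟨_, hlt⟩]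
  · simp
  · intro i hi
    rw [if_neg (fun h => hi (Fin.ext h)), mul_zero]

theorem norm_exp_two_pi_mul_I (w : ℝ) : ‖Complex.exp ((2 * Real.pi * w : ℝ) * Complex.I)‖ = 1 :=
  Complex.norm_exp_ofReal_mul_I _

theorem exists_eq_exp_two_pi_mul_I {z : ℂ} (hz : ‖z‖ = 1) :
    ∃ w ∈ Set.Icc (-(1:ℝ)/2) (1/2), z = Complex.exp ((2 * Real.pi * w : ℝ) * Complex.I) := by
  refine ⟨z.arg / (2 * Real.pi), ⟨?_, ?_⟩, ?_⟩
  · rw [le_div_iff₀ Real.two_pi_pos]; linarith [Complex.neg_pi_lt_arg z]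
  · rw [div_le_iff₀ Real.two_pi_pos]; linarith [Complex.arg_le_pi z]
  · rw [mul_div_cancel₀ _ Real.two_pi_pos.ne']
    simpa [hz] using (Complex.norm_mul_exp_arg_mul_I z).symm

theorem aVec_eq_conj_pow (f : ℕ) (w : ℝ) (m : Fin N_M) :
    aVec N_M f w m =
      (starRingEnd ℂ) (Complex.exp ((2 * Real.pi * w : ℝ) * Complex.I) ^ (f * (m : ℕ))) := by
  rw [← Complex.exp_nat_mul, ← Complex.exp_conj, aVec]
  congr 1
  simp only [map_mul, Complex.conj_ofReal, Complex.conj_I, map_natCast]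
  push_cast
  ring

theorem reInner_atomTensor {N : ℕ} (hN : N = N_F * (N_M - 1) + 1)
    (Q : Fin N_M → Fin N_l → Fin N_F → ℂ) (w : ℝ) (X : Matrix (Fin N_F) (Fin N_l) ℂ) :
    reInner Q (atomTensor N_M N_l N_F w X) =
      (∑ f, ∑ l, (starRingEnd ℂ) (∑ i : Fin N,
        Complex.exp ((2 * Real.pi * w : ℝ) * Complex.I) ^ (i : ℕ) *
          Qtilde N_M N_l N_F N Q i (f, l)) * X f l).re := by
  simp only [reInner, sum_pow_mul_Qtilde hN, atomTensor, aVec_eq_conj_pow, map_sum, map_mul,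
    Finset.sum_mul]
  congr 1
  refine (Finset.sum_congr rfl fun m _ => Finset.sum_comm).trans ?_
  rw [Finset.sum_comm]
  refine Finset.sum_congr rfl fun f _ => ?_
  rw [Finset.sum_comm]
  refine Finset.sum_congr rfl fun l _ => Finset.sum_congr rfl fun m _ => ?_
  ring

theorem sum_normSq_le_one_of_reInner_le {N : ℕ} (hl : 0 < N_l) (hF : 0 < N_F)
    (hN : N = N_F * (N_M - 1) + 1) {Q : Fin N_M → Fin N_l → Fin N_F → ℂ}
    (hQ : ∀ Z, reInner Q Z ≤ atomicNorm N_M N_l N_F Z) {z : ℂ} (hz : ‖z‖ = 1) :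
    ∑ p, Complex.normSq (∑ i : Fin N, z ^ (i : ℕ) * Qtilde N_M N_l N_F N Q i p) ≤ 1 := by
  obtain ⟨w, hw, rfl⟩ := exists_eq_exp_two_pi_mul_I hz
  let X : Matrix (Fin N_F) (Fin N_l) ℂ := fun f l => ∑ i : Fin N,
    Complex.exp ((2 * Real.pi * w : ℝ) * Complex.I) ^ (i : ℕ) * Qtilde N_M N_l N_F N Q i (f, l)
  have h := (hQ _).trans (atomicNorm_atomTensor_le (N_M := N_M) hl hF hw X)
  have hX : reInner Q (atomTensor N_M N_l N_F w X) = frobNorm X ^ 2 := by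
    rw [reInner_atomTensor hN, frobNorm_sq, Complex.re_sum]
    simp only [Complex.re_sum, X, ← Complex.normSq_eq_conj_mul_self, Complex.ofReal_re]
  rw [hX] at h
  rw [Fintype.sum_prod_type]
  have h2 := frobNorm_sq X
  simp only [X] at h2
  rw [← h2]
  nlinarith [frobNorm_nonneg X]

theorem reInner_atomTensor_le_one {N : ℕ} (hN : N = N_F * (N_M - 1) + 1)
    {Q : Fin N_M → Fin N_l → Fin N_F → ℂ}
    (hQ : ∀ z : ℂ, ‖z‖ = 1 →
      ∑ p, Complex.normSq (∑ i : Fin N, z ^ (i : ℕ) * Qtilde N_M N_l N_F N Q i p) ≤ 1)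
    (w : ℝ) {X : Matrix (Fin N_F) (Fin N_l) ℂ} (hX : frobNorm X = 1) :
    reInner Q (atomTensor N_M N_l N_F w X) ≤ 1 := by
  have h1 := hQ _ (norm_exp_two_pi_mul_I w)
  have h2 := frobNorm_sq X
  rw [hX, one_pow] at h2
  rw [Fintype.sum_prod_type] at h1
  have hmul : ∀ a b : ℂ, ((starRingEnd ℂ) a * b).re ≤
      (Complex.normSq a + Complex.normSq b) / 2 := fun a b => by
    simp only [Complex.mul_re, Complex.conj_re, Complex.conj_im, Complex.normSq_apply]
    nlinarith [sq_nonneg (a.re - b.re), sq_nonneg (a.im - b.im)]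
  rw [reInner_atomTensor hN]
  simp only [Complex.re_sum]
  refine (Finset.sum_le_sum fun f _ => Finset.sum_le_sum fun l _ => hmul _ _).trans ?_
  simp only [← Finset.sum_div, Finset.sum_add_distrib]
  linarith

theorem reInner_le_of_mem_atomicCosts {Q Y : Fin N_M → Fin N_l → Fin N_F → ℂ} {r : ℝ}
    (hQ : ∀ (w : ℝ) (X : Matrix (Fin N_F) (Fin N_l) ℂ), frobNorm X = 1 →
      reInner Q (atomTensor N_M N_l N_F w X) ≤ 1)
    (hr : r ∈ atomicCosts N_M N_l N_F Y) : reInner Q Y ≤ r := by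
  obtain ⟨K, c, w, X, hc, -, hX, hY, rfl⟩ := hr
  have h : reInner Q Y = ∑ k, c k * reInner Q (atomTensor N_M N_l N_F (w k) (X k)) := by
    simp only [reInner, ← Complex.re_ofReal_mul, ← Complex.re_sum, hY, Finset.mul_sum]
    congr 1
    rw [Finset.sum_comm (s := (Finset.univ : Finset (Fin K)))]
    refine Finset.sum_congr rfl fun m _ => ?_
    rw [Finset.sum_comm (s := (Finset.univ : Finset (Fin K)))]
    refine Finset.sum_congr rfl fun l _ => ?_
    rw [Finset.sum_comm (s := (Finset.univ : Finset (Fin K)))]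
    refine Finset.sum_congr rfl fun f _ => Finset.sum_congr rfl fun k _ => ?_
    ring
  rw [h]
  exact Finset.sum_le_sum fun k _ => mul_le_of_le_one_right (hc k) (hQ _ _ (hX k))

theorem Qtilde_smul (N : ℕ) (t : ℂ) (Q : Fin N_M → Fin N_l → Fin N_F → ℂ) :
    Qtilde N_M N_l N_F N (t • Q) = t • Qtilde N_M N_l N_F N Q := by
  ext i p
  simp [Qtilde, Rlift, Finset.mul_sum]

theorem reInner_ofReal_smul {α β γ : Type*} [Fintype α] [Fintype β] [Fintype γ] (t : ℝ)
    (Q Y : α → β → γ → ℂ) : reInner ((t : ℂ) • Q) Y = t * reInner Q Y := by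
  simp only [reInner, ← Complex.re_ofReal_mul, Finset.mul_sum, Pi.smul_apply, smul_eq_mul,
    map_mul, Complex.conj_ofReal, mul_assoc]

end AtomicNorm

/-- The atomic norm of `Y ∈ ℂ^{N_M×N_l×N_F}` equals the optimal value of the SDP:
`sup { Re⟨Q,Y⟩ : ∃ Hermitian P₀, [[P₀, Q̃],[Q̃ᴴ, I]] ⪰ 0, ∑_{i=1}^{N-k} P₀(i,i+k) = δ_{k,0} }`. -/
theorem stmt0 (N_M N_l N_F : ℕ) (hM : 0 < N_M) (hl : 0 < N_l) (hF : 0 < N_F)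
    (N : ℕ) (hN : N = N_F * (N_M - 1) + 1)
    (Y : Fin N_M → Fin N_l → Fin N_F → ℂ) :
    atomicNorm N_M N_l N_F Y =
      sSup { r : ℝ | ∃ (Q : Fin N_M → Fin N_l → Fin N_F → ℂ)
        (P₀ : Matrix (Fin N) (Fin N) ℂ),
        P₀.IsHermitian ∧
        (Matrix.fromBlocks P₀ (Qtilde N_M N_l N_F N Q) (Qtilde N_M N_l N_F N Q)ᴴ
          (1 : Matrix (Fin N_F × Fin N_l) (Fin N_F × Fin N_l) ℂ)).PosSemidef ∧
        (∀ k : ℕ, k < N →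
          (∑ i : Fin N, ∑ j : Fin N, if (j : ℕ) = (i : ℕ) + k then P₀ i j else 0)
            = if k = 0 then 1 else 0) ∧
        r = reInner Q Y } := by
  have hN0 : 0 < N := by omega
  have hfeas : ∀ (Q : Fin N_M → Fin N_l → Fin N_F → ℂ) (P₀ : Matrix (Fin N) (Fin N) ℂ),
      P₀.IsHermitian →
      (Matrix.fromBlocks P₀ (Qtilde N_M N_l N_F N Q) (Qtilde N_M N_l N_F N Q)ᴴ
        (1 : Matrix (Fin N_F × Fin N_l) (Fin N_F × Fin N_l) ℂ)).PosSemidef →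
      (∀ k : ℕ, k < N →
        (∑ i : Fin N, ∑ j : Fin N, if (j : ℕ) = (i : ℕ) + k then P₀ i j else 0)
          = if k = 0 then 1 else 0) → reInner Q Y ≤ atomicNorm N_M N_l N_F Y :=
    fun Q P₀ hP hpsd hsum => le_csInf (atomicCosts_nonempty hl hF Y) fun _ hr =>
      reInner_le_of_mem_atomicCosts (fun w _ hX => reInner_atomTensor_le_one hN
        (fun _ hz => sum_normSq_le_one_of_certificate hN0 hP hpsd hsum hz) w hX) hr
  obtain ⟨Q, hQY, hQ⟩ := exists_reInner_eq_atomicNorm hl hF Y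
  have hscaled : ∀ t : ℝ, 0 ≤ t → t < 1 → ∃ P₀ : Matrix (Fin N) (Fin N) ℂ, P₀.IsHermitian ∧
      (Matrix.fromBlocks P₀ (Qtilde N_M N_l N_F N ((t : ℂ) • Q))
        (Qtilde N_M N_l N_F N ((t : ℂ) • Q))ᴴ
        (1 : Matrix (Fin N_F × Fin N_l) (Fin N_F × Fin N_l) ℂ)).PosSemidef ∧
      ∀ k : ℕ, k < N →
        (∑ i : Fin N, ∑ j : Fin N, if (j : ℕ) = (i : ℕ) + k then P₀ i j else 0)
          = if k = 0 then 1 else 0 := fun t ht0 ht1 => by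
    refine exists_bounded_real_certificate hN0 _ fun z hz => ?_
    have h := sum_normSq_le_one_of_reInner_le hl hF hN hQ hz
    simp only [Qtilde_smul, Matrix.smul_apply, smul_eq_mul, mul_left_comm _ (t : ℂ),
      ← Finset.mul_sum, Complex.normSq_mul, Complex.normSq_ofReal]
    nlinarith [mul_le_of_le_one_right (mul_self_nonneg t) h]
  apply le_antisymm
  · have hlim : Filter.Tendsto (fun t : ℝ => t * reInner Q Y) (nhdsWithin 1 (Set.Iio 1))
        (nhds (1 * reInner Q Y)) :=
      ((continuous_id.mul continuous_const).tendsto 1).mono_left nhdsWithin_le_nhds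
    rw [one_mul] at hlim
    refine hQY.trans (le_of_tendsto hlim ?_)
    filter_upwards [Ico_mem_nhdsLT (zero_lt_one' ℝ)] with t ht
    obtain ⟨P₀, hP, hpsd, hsum⟩ := hscaled t ht.1 ht.2
    refine le_csSup ⟨atomicNorm N_M N_l N_F Y, ?_⟩
      ⟨(t : ℂ) • Q, P₀, hP, hpsd, hsum, (reInner_ofReal_smul t Q Y).symm⟩
    rintro _ ⟨Q', P', hP', hpsd', hsum', rfl⟩
    exact hfeas Q' P' hP' hpsd' hsum'
  · obtain ⟨P₀, hP, hpsd, hsum⟩ := hscaled 0 le_rfl one_pos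
    refine csSup_le ⟨_, _, P₀, hP, hpsd, hsum, rfl⟩ ?_
    rintro _ ⟨Q', P', hP', hpsd', hsum', rfl⟩
    exact hfeas Q' P' hP' hpsd' hsum'
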